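/- Let K be the algebraic closure of F_5. There exist values A, B, a0, a1, a2, a3, a4, a5 ∈ K such that the projective curve C = V(P,Q) ⊂ ℙ³(K) is nonsingular and all sixteen entries of its Hasse–Witt matrix vanish, i.e., for all 1 ≤ i, j ≤ 4 the coefficient of x^{5·e_{i1}−e_{j1}}·y^{5·e_{i2}−e_{j2}}·z^{5·e_{i3}−e_{j3}}·w^{5·e_{i4}−e_{j4}} in (P·Q)^{4} is zero. In other words, there exists a superspecial DCEC (superspecial genus-4 double cover of an elliptic curve) in characteristic 5. -/

import Mathlib

open MvPolynomial

noncomputable section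

/-- The homogeneous cubic `P = y²z − (x³ + A·x·z² + B·z³)` in `K[x,y,z,w]`. -/
def Pcubic (K : Type*) [Field K] (A B : K) : MvPolynomial (Fin 4) K :=
  X 1 ^ 2 * X 2 - (X 0 ^ 3 + C A * X 0 * X 2 ^ 2 + C B * X 2 ^ 3)

/-- The quadratic form `q` viewed in `K[x,y,z,w]`. -/
def qForm (K : Type*) [Field K] (a0 a1 a2 a3 a4 a5 : K) : MvPolynomial (Fin 4) K :=
  C a0 * X 0 ^ 2 + C a1 * X 0 * X 1 + C a2 * X 0 * X 2 +
    C a3 * X 1 ^ 2 + C a4 * X 1 * X 2 + C a5 * X 2 ^ 2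

/-- The quadric `Q = w² − q`. -/
def Qquad (K : Type*) [Field K] (a0 a1 a2 a3 a4 a5 : K) : MvPolynomial (Fin 4) K :=
  X 3 ^ 2 - qForm K a0 a1 a2 a3 a4 a5

/-- The 2×4 Jacobian matrix of `(P, Q)` evaluated at a representative `v`. -/
def jacMat {K : Type*} [Field K] (P Q : MvPolynomial (Fin 4) K) (v : Fin 4 → K) :
    Matrix (Fin 2) (Fin 4) K :=
  Matrix.of fun i k => eval v (pderiv k (![P, Q] i))

/-- The exponent matrix `(e_{ij})` with rows `(1,1,1,2), (1,1,2,1), (1,2,0,1), (2,1,1,1)`. -/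
def eMat : Fin 4 → Fin 4 → ℕ :=
  ![![1, 1, 1, 2], ![1, 1, 2, 1], ![1, 2, 0, 1], ![2, 1, 1, 1]]

/-- The Hasse–Witt matrix of `C = V(P,Q)` vanishes (the guard handles the entries whose
exponent vector has a negative component, for which the coefficient is zero trivially). -/
def HasseWittVanishes {K : Type*} [Field K] (p : ℕ) (P Q : MvPolynomial (Fin 4) K) : Prop :=
  ∀ i j : Fin 4, (∀ k : Fin 4, eMat j k ≤ p * eMat i k) →
    MvPolynomial.coeff (Finsupp.equivFunOnFinite.symm fun k => p * eMat i k - eMat j k)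
      ((P * Q) ^ (p - 1)) = 0

instance : Fact (Nat.Prime 5) := ⟨by norm_num⟩

/-- The algebraic closure of `F_5`. -/
abbrev K5 := AlgebraicClosure (ZMod 5)

/-- The exponent vector attached to a tuple. -/
def expo (t : ℕ × ℕ × ℕ × ℕ) : Fin 4 →₀ ℕ :=
  Finsupp.equivFunOnFinite.symm ![t.1, t.2.1, t.2.2.1, t.2.2.2]

/-- Sparse polynomial semantics: a list of (exponent, integer coefficient) pairs. -/
def toMv (L : List ((ℕ × ℕ × ℕ × ℕ) × ℤ)) : MvPolynomial (Fin 4) K5 :=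
  (L.map fun t => monomial (expo t.1) (t.2 : K5)).sum

/-- Product of two terms. -/
def tmul (s t : (ℕ × ℕ × ℕ × ℕ) × ℤ) : (ℕ × ℕ × ℕ × ℕ) × ℤ :=
  ((s.1.1 + t.1.1, s.1.2.1 + t.1.2.1, s.1.2.2.1 + t.1.2.2.1, s.1.2.2.2 + t.1.2.2.2), s.2 * t.2)

/-- Product of two sparse polynomials. -/
def lmul : List ((ℕ × ℕ × ℕ × ℕ) × ℤ) → List ((ℕ × ℕ × ℕ × ℕ) × ℤ) →
    List ((ℕ × ℕ × ℕ × ℕ) × ℤ)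
  | [], _ => []
  | s :: L, M => M.map (tmul s) ++ lmul L M

/-- Coefficient of a sparse polynomial. -/
def listCoeff (m : ℕ × ℕ × ℕ × ℕ) : List ((ℕ × ℕ × ℕ × ℕ) × ℤ) → ℤ
  | [] => 0
  | s :: L => bif (Nat.beq s.1.1 m.1 && (Nat.beq s.1.2.1 m.2.1 && (Nat.beq s.1.2.2.1 m.2.2.1 &&
      Nat.beq s.1.2.2.2 m.2.2.2))) then s.2 + listCoeff m L else listCoeff m L

lemma monomial_tmul (s t : (ℕ × ℕ × ℕ × ℕ) × ℤ) :
    (monomial (expo (tmul s t).1) ((tmul s t).2 : K5)) =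
      monomial (expo s.1) (s.2 : K5) * monomial (expo t.1) (t.2 : K5) := by
  rw [monomial_mul]
  congr 1
  · congr 1
    ext k
    fin_cases k <;> simp [expo, tmul]
  · simp [tmul]

lemma toMv_mul (L M : List ((ℕ × ℕ × ℕ × ℕ) × ℤ)) : toMv (lmul L M) = toMv L * toMv M := by
  induction L with
  | nil => simp [toMv, lmul]
  | cons s L ih =>
    have h1 : toMv (lmul (s :: L) M) = toMv (M.map (tmul s)) + toMv (lmul L M) := by
      simp [toMv, lmul]
    have h2 : toMv (s :: L) = monomial (expo s.1) (s.2 : K5) + toMv L := by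
      simp [toMv]
    have h3 : toMv (M.map (tmul s)) = monomial (expo s.1) (s.2 : K5) * toMv M := by
      induction M with
      | nil => simp [toMv]
      | cons t M ihM =>
        have e1 : toMv ((t :: M).map (tmul s)) =
            monomial (expo (tmul s t).1) ((tmul s t).2 : K5) + toMv (M.map (tmul s)) := by
          simp [toMv]
        have e2 : toMv (t :: M) = monomial (expo t.1) (t.2 : K5) + toMv M := by
          simp [toMv]
        have e3 : toMv (M.map (tmul s)) = monomial (expo s.1) (s.2 : K5) * toMv M := by
          clear ihM ih h1 h2 e1 e2
          induction M with
          | nil => simp [toMv]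
          | cons u M ih =>
            simp only [toMv, List.map_cons, List.sum_cons, mul_add] at ih ⊢
            rw [ih, monomial_tmul]
        rw [e1, e2, e3, monomial_tmul, mul_add]
    rw [h1, h2, h3, ih, add_mul]

lemma expo_eq_iff (s m : ℕ × ℕ × ℕ × ℕ) : expo s = expo m ↔
    (s.1 = m.1 ∧ s.2.1 = m.2.1 ∧ s.2.2.1 = m.2.2.1 ∧ s.2.2.2 = m.2.2.2) := by
  simp [expo]

lemma coeff_toMv (m : ℕ × ℕ × ℕ × ℕ) (L : List ((ℕ × ℕ × ℕ × ℕ) × ℤ)) :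
    coeff (expo m) (toMv L) = ((listCoeff m L : ℤ) : K5) := by
  induction L with
  | nil => simp [toMv, listCoeff]
  | cons s L ih =>
    have h2 : toMv (s :: L) = monomial (expo s.1) (s.2 : K5) + toMv L := by
      simp [toMv]
    rw [h2, coeff_add, ih, coeff_monomial, listCoeff]
    by_cases h : expo s.1 = expo m
    · rw [if_pos h]
      rw [expo_eq_iff] at h
      simp [h]
    · rw [if_neg h]
      rw [expo_eq_iff] at h
      have : (Nat.beq s.1.1 m.1 && (Nat.beq s.1.2.1 m.2.1 && (Nat.beq s.1.2.2.1 m.2.2.1 &&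
          Nat.beq s.1.2.2.2 m.2.2.2))) = false := by
        rw [Bool.eq_false_iff]
        intro h'
        apply h
        simpa using h'
      rw [this]
      simp

/-- The cubic as a sparse polynomial. -/
def lP : List ((ℕ × ℕ × ℕ × ℕ) × ℤ) := [((0, 2, 1, 0), 1), ((3, 0, 0, 0), -1), ((0, 0, 3, 0), -3)]

/-- The quadric as a sparse polynomial. -/
def lQ : List ((ℕ × ℕ × ℕ × ℕ) × ℤ) := [((0, 0, 0, 2), 1), ((0, 2, 0, 0), -1), ((0, 0, 2, 0), 1)]

/-- The square of the product as a sparse polynomial. -/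
def lPQ2 : List ((ℕ × ℕ × ℕ × ℕ) × ℤ) := lmul (lmul lP lQ) (lmul lP lQ)

lemma monomial_expo (a b c d : ℕ) (n : ℤ) : monomial (expo (a, b, c, d)) (n : K5) =
    C (n : K5) * (X 0 ^ a * X 1 ^ b * X 2 ^ c * X 3 ^ d) := by
  rw [monomial_eq, Finsupp.prod_fintype _ _ (by simp)]
  simp [expo, Fin.prod_univ_four]

lemma toMv_lP : toMv lP = Pcubic K5 0 3 := by
  simp only [toMv, lP, List.map_cons, List.map_nil, List.sum_cons, List.sum_nil, monomial_expo,
    Pcubic]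
  simp only [Int.cast_one, Int.cast_neg, Int.cast_ofNat, map_neg, map_one, map_zero]
  ring

lemma toMv_lQ : toMv lQ = Qquad K5 0 0 0 1 0 (-1) := by
  simp only [toMv, lQ, List.map_cons, List.map_nil, List.sum_cons, List.sum_nil, monomial_expo,
    Qquad, qForm]
  simp only [Int.cast_one, Int.cast_neg, map_neg, map_one, map_zero]
  ring

lemma int_coeffs : ∀ i j : Fin 4, (∀ k : Fin 4, eMat j k ≤ 5 * eMat i k) →
    listCoeff (5 * eMat i 0 - eMat j 0, 5 * eMat i 1 - eMat j 1, 5 * eMat i 2 - eMat j 2,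
      5 * eMat i 3 - eMat j 3) (lmul lPQ2 lPQ2) % 5 = 0 := by
  decide +kernel

lemma five_K5 : (5 : K5) = 0 := by
  have : ((5 : ℕ) : K5) = 0 := CharP.cast_eq_zero K5 5
  exact_mod_cast this

lemma hw : HasseWittVanishes 5 (Pcubic K5 0 3) (Qquad K5 0 0 0 1 0 (-1)) := by
  intro i j hij
  have h1 : (Pcubic K5 0 3 * Qquad K5 0 0 0 1 0 (-1)) ^ (5 - 1) = toMv (lmul lPQ2 lPQ2) := by
    rw [lPQ2, toMv_mul, toMv_mul, toMv_mul, toMv_lP, toMv_lQ]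
    ring
  have h2 : (Finsupp.equivFunOnFinite.symm fun k => 5 * eMat i k - eMat j k) =
      expo (5 * eMat i 0 - eMat j 0, 5 * eMat i 1 - eMat j 1, 5 * eMat i 2 - eMat j 2,
      5 * eMat i 3 - eMat j 3) := by
    ext k
    fin_cases k <;> simp [expo]
  rw [h1, h2, coeff_toMv]
  obtain ⟨c, hc⟩ := Int.dvd_of_emod_eq_zero (int_coeffs i j hij)
  rw [hc]
  push_cast
  rw [five_K5, zero_mul]

lemma minor_zero (M : Matrix (Fin 2) (Fin 4) K5) (h : M.rank ≤ 1) (a b : Fin 4) :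
    M 0 a * M 1 b - M 0 b * M 1 a = 0 := by
  by_contra hne
  have hd : (M.submatrix id ![a, b]).det ≠ 0 := by
    rw [Matrix.det_fin_two]
    simpa using hne
  have hr : (M.submatrix id ![a, b]).rank = 2 := by
    have := Matrix.rank_of_isUnit (M.submatrix id ![a, b])
      ((Matrix.isUnit_iff_isUnit_det _).2 (isUnit_iff_ne_zero.2 hd))
    simpa using this
  have := Matrix.rank_submatrix_le M id ![a, b]
  omega

lemma nonsing (v : Fin 4 → K5) (hv : v ≠ 0) (hP : eval v (Pcubic K5 0 3) = 0)
    (hQ : eval v (Qquad K5 0 0 0 1 0 (-1)) = 0) :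
    ¬ (jacMat (Pcubic K5 0 3) (Qquad K5 0 0 0 1 0 (-1)) v).rank ≤ 1 := by
  intro hr
  have m := minor_zero _ hr
  have h01 := m 0 1
  have h02 := m 0 2
  have h03 := m 0 3
  have h12 := m 1 2
  have five := five_K5
  have two : (2 : K5) ≠ 0 := by
    intro h
    have : (1 : K5) = 0 := by linear_combination five - 2 * h
    exact one_ne_zero this
  have three : (3 : K5) ≠ 0 := by
    intro h
    have : (1 : K5) = 0 := by linear_combination 2 * h - five
    exact one_ne_zero this
  simp [jacMat, Pcubic, Qquad, qForm, pderiv_X] at h01 h02 h03 h12 hP hQ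
  simp only [two, three, false_or] at h01 h02 h03
  have hx : v 0 = 0 := by
    by_contra hx
    have hy := h01.resolve_left hx
    have hz := h02.resolve_left hx
    rw [hy, hz] at hP
    have : v 0 ^ 3 = 0 := by linear_combination -hP
    exact hx (pow_eq_zero_iff (by norm_num) |>.1 this)
  rw [hx] at hP
  have hyz : v 1 = 0 ∧ v 2 = 0 := by
    have h : 2 * v 1 * (v 1 ^ 2 - 2 * v 2 ^ 2) = 0 := by
      linear_combination h12 + 2 * v 1 * v 2 ^ 2 * five
    rcases mul_eq_zero.1 h with h | h
    · have hy : v 1 = 0 := (mul_eq_zero.1 h).resolve_left two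
      rw [hy] at hP
      have : 3 * v 2 ^ 3 = 0 := by linear_combination -hP
      exact ⟨hy, pow_eq_zero_iff (by norm_num) |>.1 ((mul_eq_zero.1 this).resolve_left three)⟩
    · have : v 2 ^ 3 = 0 := by linear_combination -hP + v 2 * h
      have hz : v 2 = 0 := pow_eq_zero_iff (by norm_num) |>.1 this
      rw [hz] at h
      have hy : v 1 ^ 2 = 0 := by linear_combination h
      exact ⟨pow_eq_zero_iff (by norm_num) |>.1 hy, hz⟩
  obtain ⟨hy, hz⟩ := hyz
  rw [hy, hz] at hQ
  have hw2 : v 3 ^ 2 = 0 := by linear_combination hQ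
  have hw : v 3 = 0 := pow_eq_zero_iff (by norm_num) |>.1 hw2
  apply hv
  ext k
  fin_cases k
  · exact hx
  · exact hy
  · exact hz
  · exact hw

/-- over the algebraic closure of `F_5` there is a choice of parameters
`A, B, a0, …, a5` making `C = V(P,Q)` nonsingular with vanishing Hasse–Witt matrix;
there exists a superspecial DCEC in characteristic 5. -/
theorem stmt16 :
    ∃ A B a0 a1 a2 a3 a4 a5 : K5,
      (∀ v : Fin 4 → K5, v ≠ 0 →
          eval v (Pcubic K5 A B) = 0 → eval v (Qquad K5 a0 a1 a2 a3 a4 a5) = 0 →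
          ¬ (jacMat (Pcubic K5 A B) (Qquad K5 a0 a1 a2 a3 a4 a5) v).rank ≤ 1) ∧
      HasseWittVanishes 5 (Pcubic K5 A B) (Qquad K5 a0 a1 a2 a3 a4 a5) :=
  ⟨0, 3, 0, 0, 0, 1, 0, -1, nonsing, hw⟩

end
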